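/- Let g be continuous on the circle |z − c| = r and suppose g extends meromorphically into the disc D(c,r) with only pole at c of order at most ν. Then the extension exists if and only if the complex moments ∮_{|z−c|=r} g(z)(z − c)^m dz vanish for all integers m ≥ ν. -/

import Mathlib

open Complex Metric

/-- The moments vanishing kills the reflected Cauchy kernel. -/
lemma aux_reflect (c : ℂ) (r : ℝ) (hr : 0 < r) (h : ℂ → ℂ) (hh : ContinuousOn h (sphere c r))
    (hm : ∀ m : ℕ, (∮ z in C(c, r), h z * (z - c) ^ m) = 0) (b : ℂ) (hb : ‖b‖ * r < 1) :
    (∮ z in C(c, r), h z * (1 - b * (z - c))⁻¹) = 0 := by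
  have hne : ∀ z ∈ sphere c r, 1 - b * (z - c) ≠ 0 := by
    intro z hz h0
    have h1 : ‖b * (z - c)‖ = 1 := by
      rw [← sub_eq_zero.1 h0]; simp
    rw [norm_mul, mem_sphere_iff_norm.1 hz] at h1
    linarith
  have hc : ContinuousOn (fun z => h z * (1 - b * (z - c))⁻¹) (sphere c r) :=
    hh.mul (ContinuousOn.inv₀ (by fun_prop) hne)
  have hstep : ∀ N : ℕ, (∮ z in C(c, r), h z * (1 - b * (z - c))⁻¹) =
      ∮ z in C(c, r), h z * (1 - b * (z - c))⁻¹ * (b * (z - c)) ^ N := by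
    intro N
    induction N with
    | zero => simp
    | succ N ih =>
      rw [ih, ← sub_eq_zero, ← circleIntegral.integral_sub]
      · have : (∮ z in C(c, r), b ^ N * (h z * (z - c) ^ N)) = 0 := by
          rw [circleIntegral.integral_const_mul, hm, mul_zero]
        rw [← this]
        apply circleIntegral.integral_congr hr.le
        intro z hz
        have := hne z hz
        simp only [mul_pow, pow_succ]
        field_simp
      · exact (hc.mul (by fun_prop)).circleIntegrable hr.le
      · exact (hc.mul (by fun_prop)).circleIntegrable hr.le
  obtain ⟨M, hM⟩ := (isCompact_sphere c r).exists_bound_of_continuousOn hc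
  have hbound : ∀ N : ℕ, ‖∮ z in C(c, r), h z * (1 - b * (z - c))⁻¹‖ ≤
      2 * Real.pi * r * (M * (‖b‖ * r) ^ N) := by
    intro N
    rw [hstep N]
    apply circleIntegral.norm_integral_le_of_norm_le_const hr.le
    intro z hz
    rw [norm_mul, norm_pow, norm_mul b, mem_sphere_iff_norm.1 hz]
    gcongr
    exact hM z hz
  have hlim : Filter.Tendsto (fun N : ℕ => 2 * Real.pi * r * (M * (‖b‖ * r) ^ N)) Filter.atTop
      (nhds (2 * Real.pi * r * (M * 0))) :=
    ((tendsto_pow_atTop_nhds_zero_of_lt_one (by positivity) hb).const_mul M).const_mul _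
  have := ge_of_tendsto' hlim hbound
  simp only [mul_zero] at this
  exact norm_le_zero_iff.1 this

lemma aux_kernel (c : ℂ) (r : ℝ) (hr : 0 < r) (z w : ℂ) (hz : z ∈ ball c r)
    (hw : w ∈ sphere c r) :
    (w - c)⁻¹ * (poissonKernel c z w : ℂ) = (w - z)⁻¹ +
      (starRingEnd ℂ (z - c) / r ^ 2) *
        (1 - (starRingEnd ℂ (z - c) / r ^ 2) * (w - c))⁻¹ := by
  rw [mem_sphere_iff_norm] at hw
  rw [mem_ball_iff_norm] at hz
  have hzw : z - c ≠ w - c := fun h => by rw [h] at hz; linarith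
  have e1 : w - z = (w - c) - (z - c) := by ring
  rw [e1, poissonKernel_def]
  generalize z - c = x at *
  generalize w - c = y at *
  have hy : y ≠ 0 := by rintro rfl; simp at hw; linarith
  have hr2 : (r : ℂ) ^ 2 = y * starRingEnd ℂ y := by
    rw [Complex.mul_conj, normSq_eq_norm_sq, hw]; simp
  have hd : y - x ≠ 0 := sub_ne_zero.2 hzw.symm
  have hd' : starRingEnd ℂ y - starRingEnd ℂ x ≠ 0 := by
    rw [← map_sub]; exact (map_ne_zero _).2 hd
  have hcy : starRingEnd ℂ y ≠ 0 := by simpa using hy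
  have n1 : ∀ u : ℂ, ((‖u‖ : ℂ)) ^ 2 = u * starRingEnd ℂ u := by
    intro u; rw [Complex.mul_conj, normSq_eq_norm_sq]; simp
  push_cast
  rw [n1, n1, n1, hr2, map_sub]
  have e2 : 1 - starRingEnd ℂ x / (y * starRingEnd ℂ y) * y =
      (starRingEnd ℂ y - starRingEnd ℂ x) / starRingEnd ℂ y := by
    field_simp
  rw [e2]
  field_simp
  ring

/-- The Cauchy integral equals the Poisson integral. -/
lemma aux_poisson (c : ℂ) (r : ℝ) (hr : 0 < r) (h : ℂ → ℂ) (hh : ContinuousOn h (sphere c r))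
    (hm : ∀ m : ℕ, (∮ z in C(c, r), h z * (z - c) ^ m) = 0) (z : ℂ) (hz : z ∈ ball c r) :
    (2 * Real.pi * I : ℂ)⁻¹ • (∮ w in C(c, r), (w - z)⁻¹ • h w) =
      Real.circleAverage (fun w => poissonKernel c z w • h w) c r := by
  rw [Real.circleAverage_eq_circleIntegral hr.ne']
  congr 1
  set b : ℂ := starRingEnd ℂ (z - c) / r ^ 2 with hbdef
  have hz' := mem_ball_iff_norm.1 hz
  have hb : ‖b‖ * r < 1 := by
    have : ‖b‖ * r = ‖z - c‖ / r := by
      rw [hbdef, norm_div, RCLike.norm_conj]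
      simp [abs_of_pos hr]
      field_simp
    rw [this, div_lt_one hr]; exact hz'
  have hne : ∀ w ∈ sphere c r, 1 - b * (w - c) ≠ 0 := by
    intro z hz h0
    have h1 : ‖b * (z - c)‖ = 1 := by
      rw [← sub_eq_zero.1 h0]; simp
    rw [norm_mul, mem_sphere_iff_norm.1 hz] at h1
    linarith
  have hne2 : ∀ w ∈ sphere c r, w - z ≠ 0 := by
    intro w hw h0
    rw [sub_eq_zero.1 h0, mem_sphere_iff_norm] at hw
    linarith
  have h0 : (∮ w in C(c, r), b * (h w * (1 - b * (w - c))⁻¹)) = 0 := by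
    rw [circleIntegral.integral_const_mul, aux_reflect c r hr h hh hm b hb, mul_zero]
  rw [← add_zero (∮ w in C(c, r), (w - z)⁻¹ • h w), ← h0, ← circleIntegral.integral_add]
  · apply circleIntegral.integral_congr hr.le
    intro w hw
    have := aux_kernel c r hr z w hz hw
    simp only [smul_eq_mul, Complex.real_smul]
    rw [← mul_assoc (w - c)⁻¹, this, ← hbdef]
    ring
  · exact ContinuousOn.circleIntegrable hr.le
      ((ContinuousOn.inv₀ (by fun_prop) hne2).smul hh)
  · exact ContinuousOn.circleIntegrable hr.le
      (continuousOn_const.mul (hh.mul (ContinuousOn.inv₀ (by fun_prop) hne)))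

lemma aux_bound (c : ℂ) (r : ℝ) (hr : 0 < r) (h : ℂ → ℂ) (hh : ContinuousOn h (sphere c r))
    (w₀ : ℂ) (a C : ℝ) (hC : 0 ≤ C)
    (hb : ∀ w ∈ sphere c r, ‖h w - h w₀‖ ≤ a + C * ‖w - w₀‖ ^ 2) (z : ℂ) (hz : z ∈ ball c r) :
    ‖Real.circleAverage (fun w => poissonKernel c z w • h w) c r - h w₀‖ ≤
      a + 2 * C * ‖z - w₀‖ ^ 2 + 2 * C * (r ^ 2 - ‖z - c‖ ^ 2) := by
  have hz' := mem_ball_iff_norm.1 hz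
  have hpos : ∀ w ∈ sphere c r, 0 < ‖w - z‖ := by
    intro w hw
    rw [norm_pos_iff]
    intro h0
    rw [sub_eq_zero.1 h0, mem_sphere_iff_norm] at hw
    linarith
  have hPeq : ∀ w ∈ sphere c r, poissonKernel c z w = (r ^ 2 - ‖z - c‖ ^ 2) / ‖w - z‖ ^ 2 := by
    intro w hw
    rw [poissonKernel_def, mem_sphere_iff_norm.1 hw]
    simp
  have hd : 0 ≤ r ^ 2 - ‖z - c‖ ^ 2 := by nlinarith [norm_nonneg (z - c)]
  have hPc : ContinuousOn (poissonKernel c z) (sphere c r) := by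
    refine ContinuousOn.congr (f := fun w => (r ^ 2 - ‖z - c‖ ^ 2) / ‖w - z‖ ^ 2) ?_ hPeq
    exact ContinuousOn.div (by fun_prop) (by fun_prop) fun w hw => (pow_pos (hpos w hw) 2).ne'
  have one : ∀ a : ℂ, Real.circleAverage (fun w => poissonKernel c z w • a) c r = a := by
    intro a
    have := DiffContOnCl.circleAverage_poissonKernel_smul (R := r) (c := c) (w := z)
      (f := fun _ => a) (by exact diffContOnCl_const) hz
    exact this
  have oneR : ∀ a : ℝ, Real.circleAverage (fun w => poissonKernel c z w * a) c r = a := by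
    intro a
    have h1 := one a
    have h2 := Complex.reCLM.circleAverage_comp_comm (c := c) (R := r)
      (f := fun w => poissonKernel c z w • (a : ℂ))
      (ContinuousOn.circleIntegrable hr.le (hPc.smul continuousOn_const))
    rw [h1] at h2
    simpa [Function.comp_def] using h2
  have hsub : Real.circleAverage (fun w => poissonKernel c z w • h w) c r - h w₀ =
      Real.circleAverage (fun w => poissonKernel c z w • (h w - h w₀)) c r := by
    conv_lhs => rw [← one (h w₀)]
    rw [← Real.circleAverage_fun_sub]
    · simp only [smul_sub]
    · exact ContinuousOn.circleIntegrable hr.le (hPc.smul hh)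
    · exact ContinuousOn.circleIntegrable hr.le (hPc.smul continuousOn_const)
  rw [hsub]
  have hnorm : ∀ f : ℂ → ℂ, ‖Real.circleAverage f c r‖ ≤
      Real.circleAverage (fun w => ‖f w‖) c r := by
    intro f
    rw [Real.circleAverage, Real.circleAverage, norm_smul, smul_eq_mul, Real.norm_eq_abs,
      abs_of_pos (inv_pos.2 Real.two_pi_pos)]
    gcongr
    exact intervalIntegral.norm_integral_le_integral_norm Real.two_pi_pos.le
  refine (hnorm _).trans ?_
  have hfin : Real.circleAverage (fun w => poissonKernel c z w * (a + 2 * C * ‖z - w₀‖ ^ 2) +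
      2 * C * (r ^ 2 - ‖z - c‖ ^ 2)) c r =
      a + 2 * C * ‖z - w₀‖ ^ 2 + 2 * C * (r ^ 2 - ‖z - c‖ ^ 2) := by
    rw [Real.circleAverage_fun_add, oneR, Real.circleAverage_const]
    · exact ContinuousOn.circleIntegrable hr.le (hPc.mul continuousOn_const)
    · exact circleIntegrable_const _ _ _
  rw [← hfin]
  apply Real.circleAverage_mono
  · exact ContinuousOn.circleIntegrable hr.le (hPc.smul (hh.sub continuousOn_const)).norm
  · exact ContinuousOn.circleIntegrable hr.le
      ((hPc.mul continuousOn_const).add continuousOn_const)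
  · intro w hw
    rw [abs_of_pos hr] at hw
    have hp := hpos w hw
    have hP0 : 0 ≤ poissonKernel c z w := by rw [hPeq w hw]; positivity
    have hPm : poissonKernel c z w * ‖w - z‖ ^ 2 = r ^ 2 - ‖z - c‖ ^ 2 := by
      rw [hPeq w hw]; field_simp
    have htri : ‖w - w₀‖ ^ 2 ≤ 2 * ‖w - z‖ ^ 2 + 2 * ‖z - w₀‖ ^ 2 := by
      have : ‖w - w₀‖ ≤ ‖w - z‖ + ‖z - w₀‖ := norm_sub_le_norm_sub_add_norm_sub _ _ _
      nlinarith [norm_nonneg (w - w₀), sq_nonneg (‖w - z‖ - ‖z - w₀‖)]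
    rw [norm_smul, Real.norm_eq_abs, abs_of_nonneg hP0, ← hPm]
    calc poissonKernel c z w * ‖h w - h w₀‖
        ≤ poissonKernel c z w * (a + C * (2 * ‖w - z‖ ^ 2 + 2 * ‖z - w₀‖ ^ 2)) := by
          gcongr
          exact (hb w hw).trans (by gcongr)
      _ = _ := by ring

lemma aux_quad (c : ℂ) (r : ℝ) (h : ℂ → ℂ) (hh : ContinuousOn h (sphere c r))
    (w₀ : ℂ) (hw₀ : w₀ ∈ sphere c r) (ε : ℝ) (hε : 0 < ε) :
    ∃ C : ℝ, 0 ≤ C ∧ ∀ w ∈ sphere c r, ‖h w - h w₀‖ ≤ ε + C * ‖w - w₀‖ ^ 2 := by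
  obtain ⟨M, hM⟩ := (isCompact_sphere c r).exists_bound_of_continuousOn hh
  obtain ⟨δ, hδ, hd⟩ := Metric.continuousOn_iff.1 hh w₀ hw₀ ε hε
  have hM0 : 0 ≤ M := (norm_nonneg _).trans (hM w₀ hw₀)
  refine ⟨2 * M / δ ^ 2, by positivity, fun w hw => ?_⟩
  rcases lt_or_ge (dist w w₀) δ with h1 | h1
  · have := hd w hw h1
    rw [dist_eq_norm] at this
    have : 0 ≤ 2 * M / δ ^ 2 * ‖w - w₀‖ ^ 2 := by positivity
    linarith
  · rw [dist_eq_norm] at h1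
    have h2 : ‖h w - h w₀‖ ≤ 2 * M := by
      have := norm_sub_le (h w) (h w₀)
      linarith [hM w hw, hM w₀ hw₀]
    have h3 : 2 * M = 2 * M / δ ^ 2 * δ ^ 2 := by field_simp
    have h4 : 2 * M / δ ^ 2 * δ ^ 2 ≤ 2 * M / δ ^ 2 * ‖w - w₀‖ ^ 2 := by gcongr
    linarith

/-- The extension in the holomorphic case. -/
lemma aux_holo (c : ℂ) (r : ℝ) (hr : 0 < r) (h : ℂ → ℂ) (hh : ContinuousOn h (sphere c r))
    (hm : ∀ m : ℕ, (∮ z in C(c, r), h z * (z - c) ^ m) = 0) :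
    ∃ F : ℂ → ℂ, ContinuousOn F (closedBall c r) ∧ DifferentiableOn ℂ F (ball c r) ∧
      ∀ z ∈ sphere c r, F z = h z := by
  classical
  set H : ℂ → ℂ := fun z => (2 * Real.pi * I : ℂ)⁻¹ • (∮ w in C(c, r), (w - z)⁻¹ • h w) with hH
  have hHd : DifferentiableOn ℂ H (ball c r) := by
    obtain ⟨R, hR⟩ : ∃ R : NNReal, (R : ℝ) = r := ⟨r.toNNReal, Real.coe_toNNReal r hr.le⟩
    clear_value H
    subst hR
    have h2 := (hasFPowerSeriesOn_cauchy_integral (f := h) (c := c) (R := R)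
      (hh.circleIntegrable hr.le) (by exact_mod_cast hr)).differentiableOn
    rw [Metric.eball_coe] at h2
    rw [hH]
    exact h2
  set F : ℂ → ℂ := fun z => if z ∈ ball c r then H z else h z with hF
  have hFb : ∀ z ∈ ball c r, F z = H z := fun z hz => if_pos hz
  have hFs : ∀ z ∈ sphere c r, F z = h z := fun z hz => if_neg (by
    rw [mem_ball, mem_sphere.1 hz]; exact lt_irrefl _)
  have hFd : DifferentiableOn ℂ F (ball c r) := hHd.congr hFb
  refine ⟨F, ?_, hFd, hFs⟩
  intro w₀ hw₀
  rcases (mem_closedBall.1 hw₀).lt_or_eq with hlt | heq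
  · exact (hFd.differentiableAt (isOpen_ball.mem_nhds hlt)).continuousAt.continuousWithinAt
  · have hs : w₀ ∈ sphere c r := heq
    rw [Metric.continuousWithinAt_iff']
    intro ε hε
    obtain ⟨C, hC, hb⟩ := aux_quad c r h hh w₀ hs (ε / 2) (half_pos hε)
    have key : ∀ z ∈ closedBall c r, dist (F z) (F w₀) ≤
        ε / 2 + 2 * C * ‖z - w₀‖ ^ 2 + 2 * C * (r ^ 2 - ‖z - c‖ ^ 2) := by
      intro z hz
      rw [hFs w₀ hs, dist_eq_norm]
      rcases (mem_closedBall.1 hz).lt_or_eq with hzl | hze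
      · rw [hFb z hzl, hH]
        simp only []
        rw [aux_poisson c r hr h hh hm z hzl]
        exact aux_bound c r hr h hh w₀ _ C hC hb z hzl
      · rw [hFs z hze]
        have h1 := hb z hze
        rw [dist_eq_norm] at hze
        rw [hze]
        nlinarith [mul_nonneg hC (sq_nonneg ‖z - w₀‖)]
    have hlim : ContinuousAt (fun z : ℂ =>
        ε / 2 + 2 * C * ‖z - w₀‖ ^ 2 + 2 * C * (r ^ 2 - ‖z - c‖ ^ 2)) w₀ := by fun_prop
    have hval : ε / 2 + 2 * C * ‖w₀ - w₀‖ ^ 2 + 2 * C * (r ^ 2 - ‖w₀ - c‖ ^ 2) < ε := by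
      rw [mem_sphere_iff_norm.1 hs]; simp; linarith
    have hev := hlim.eventually_lt_const hval
    filter_upwards [self_mem_nhdsWithin, mem_nhdsWithin_of_mem_nhds hev] with z hz1 hz2
    exact (key z hz1).trans_lt hz2

/-- a continuous g on the circle |z-c| = r admits a meromorphic
extension into D(c,r), continuous up to the boundary away from its only pole at c
of order ≤ ν, iff the complex moments ∮ g(z)(z-c)^m dz vanish for all m ≥ ν. -/
theorem stmt19 (c : ℂ) (r : ℝ) (hr : 0 < r) (ν : ℕ) (g : ℂ → ℂ)
    (hg : ContinuousOn g (sphere c r)) :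
    (∃ G : ℂ → ℂ, ContinuousOn G (closedBall c r \ {c}) ∧
        DifferentiableOn ℂ G (ball c r \ {c}) ∧
        (∃ A : ℂ → ℂ, DifferentiableOn ℂ A (ball c r) ∧
          ∀ z ∈ ball c r \ {c}, A z = (z - c) ^ ν * G z) ∧
        ∀ z ∈ sphere c r, G z = g z) ↔
      ∀ m : ℕ, ν ≤ m → (∮ z in C(c, r), g z * (z - c) ^ m) = 0 := by
  classical
  constructor
  · rintro ⟨G, hGc, -, ⟨A, hA, hAG⟩, hGg⟩ m hm
    obtain ⟨k, rfl⟩ := Nat.exists_eq_add_of_le hm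
    set B : ℂ → ℂ := fun z => if z ∈ ball c r then A z else (z - c) ^ ν * G z with hB
    have hBb : ∀ z ∈ ball c r, B z = A z := fun z hz => if_pos hz
    have hBd : DifferentiableOn ℂ B (ball c r) := hA.congr hBb
    have hBo : ∀ z, z ≠ c → B z = (z - c) ^ ν * G z := by
      intro z hz
      by_cases h : z ∈ ball c r
      · rw [hBb z h, hAG z ⟨h, hz⟩]
      · exact if_neg h
    have hBc : ContinuousOn B (closedBall c r) := by
      intro z hz
      by_cases h : z = c
      · rw [h]
        exact (hBd.differentiableAt (isOpen_ball.mem_nhds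
          (mem_ball_self hr))).continuousAt.continuousWithinAt
      · have h1 : ContinuousOn B (closedBall c r \ {c}) := by
          refine ContinuousOn.congr (f := fun z => (z - c) ^ ν * G z) ?_ fun z hz => hBo z hz.2
          exact ContinuousOn.mul (by fun_prop) hGc
        refine (h1 z ⟨hz, h⟩).mono_of_mem_nhdsWithin ?_
        exact Filter.inter_mem self_mem_nhdsWithin
          (mem_nhdsWithin_of_mem_nhds (isOpen_ne.mem_nhds h))
    have h0 : (∮ z in C(c, r), B z * (z - c) ^ k) = 0 := by
      apply circleIntegral_eq_zero_of_differentiable_on_off_countable hr.le Set.countable_empty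
      · exact hBc.mul (by fun_prop)
      · intro z hz
        have := hBd.differentiableAt (isOpen_ball.mem_nhds hz.1)
        fun_prop
    rw [← h0]
    apply circleIntegral.integral_congr hr.le
    intro z hz
    have hzc : z ≠ c := by
      rintro rfl
      simp at hz
      linarith
    simp only []
    rw [hBo z hzc, hGg z hz, pow_add]
    ring
  · intro hm
    obtain ⟨F, hFc, hFd, hFs⟩ := aux_holo c r hr (fun z => g z * (z - c) ^ ν)
      (hg.mul (by fun_prop)) (by
        intro m
        rw [← hm (ν + m) (Nat.le_add_right _ _)]
        congr 1
        ext z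
        rw [pow_add]; ring)
    have hne : ∀ z : ℂ, z ≠ c → (z - c) ^ ν ≠ 0 := fun z hz => pow_ne_zero _ (sub_ne_zero.2 hz)
    refine ⟨fun z => F z / (z - c) ^ ν, ?_, ?_, ⟨F, hFd, ?_⟩, ?_⟩
    · exact (hFc.mono Set.sdiff_subset).div (by fun_prop) fun z hz => hne z hz.2
    · exact (hFd.mono Set.sdiff_subset).div (by fun_prop) fun z hz => hne z hz.2
    · intro z hz
      have := hne z hz.2
      field_simp
    · intro z hz
      have hzc : z ≠ c := by
        rintro rfl
        simp at hz
        linarith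
      have := hne z hzc
      simp only []
      rw [hFs z hz]
      field_simp
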